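/- Let γ̄_S, γ̄_R > 0 and a_1 > 0 with γ̄_R ≠ a_1·γ̄_S, and let X, Y be independent exponential random variables with means γ̄_S and γ̄_R respectively. Define E₁(z) = ∫_z^∞ e^{−u}/u du for z > 0. Then E[ log₂( 1 + a_1·X/(Y + 1) ) ] = (1/ln 2) · ( a_1·γ̄_S/(γ̄_R − a_1·γ̄_S) ) · ( e^{1/γ̄_R}·E₁(1/γ̄_R) − e^{1/(a_1·γ̄_S)}·E₁(1/(a_1·γ̄_S)) ). -/

import Mathlib

open MeasureTheory ProbabilityTheory Real

/-- `X` is exponentially distributed with mean `γ` under `μ`: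
`P(X > x) = exp (-x/γ)` for all `x ≥ 0`. -/
def IsExpMean {Ω : Type*} [MeasurableSpace Ω] (μ : Measure Ω) (X : Ω → ℝ) (γ : ℝ) : Prop :=
  ∀ x : ℝ, 0 ≤ x → μ {ω | x < X ω} = ENNReal.ofReal (Real.exp (-x / γ))

/-- The exponential integral `E₁ z = ∫_z^∞ e^{-u}/u du`. -/
noncomputable def expInt (z : ℝ) : ℝ := ∫ u in Set.Ioi z, Real.exp (-u) / u

/-- Layer-cake formula for real integrals: `E[G(f)] = ∫₀^∞ P(f > t) G'(t) dt` when `G(0) = 0` and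
`G` is nondecreasing. -/
lemma integral_comp_eq_integral_tail_mul_deriv {Ω : Type*} [MeasurableSpace Ω] {μ : Measure Ω}
    {f : Ω → ℝ} {G g p : ℝ → ℝ} (hf : 0 ≤ᵐ[μ] f) (hfm : Measurable f) (hGm : Measurable G)
    (hG : ∀ x, 0 ≤ x → HasDerivAt G (g x) x) (hG0 : G 0 = 0)
    (hg : ContinuousOn g (Set.Ici 0)) (hg0 : ∀ x, 0 ≤ x → 0 ≤ g x)
    (hpm : Measurable p) (hp : ∀ t, 0 < t → 0 ≤ p t)
    (htail : ∀ t, 0 < t → μ {ω | t < f ω} = ENNReal.ofReal (p t)) :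
    ∫ ω, G (f ω) ∂μ = ∫ t in Set.Ioi 0, p t * g t := by
  have hii : ∀ x, 0 ≤ x → IntervalIntegrable g volume 0 x := fun x hx =>
    (hg.mono (by rw [Set.uIcc_of_le hx]; exact Set.Icc_subset_Ici_self)).intervalIntegrable
  have hFTC : ∀ x, 0 ≤ x → ∫ t in (0 : ℝ)..x, g t = G x := fun x hx => by
    rw [intervalIntegral.integral_eq_sub_of_hasDerivAt (f := G) _ (hii x hx), hG0, sub_zero]
    intro y hy
    rw [Set.uIcc_of_le hx] at hy
    exact hG y hy.1
  have hGnn : ∀ x, 0 ≤ x → 0 ≤ G x := fun x hx => by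
    rw [← hFTC x hx]
    exact intervalIntegral.integral_nonneg hx fun t ht => hg0 t ht.1
  have hlc := lintegral_comp_eq_lintegral_meas_lt_mul μ hf hfm.aemeasurable
    (fun t ht => hii t ht.le)
    ((ae_restrict_mem measurableSet_Ioi).mono fun t ht => hg0 t (le_of_lt ht))
  rw [integral_eq_lintegral_of_nonneg_ae (hf.mono fun ω hω => hGnn _ hω)
      (hGm.comp hfm).aestronglyMeasurable,
    integral_eq_lintegral_of_nonneg_ae
      ((ae_restrict_mem measurableSet_Ioi).mono fun t ht =>
        mul_nonneg (hp t ht) (hg0 t (le_of_lt ht)))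
      (hpm.aestronglyMeasurable.mul
        ((hg.mono Set.Ioi_subset_Ici_self).aestronglyMeasurable measurableSet_Ioi))]
  congr 1
  calc ∫⁻ ω, ENNReal.ofReal (G (f ω)) ∂μ
      = ∫⁻ ω, ENNReal.ofReal (∫ t in (0 : ℝ)..f ω, g t) ∂μ :=
        lintegral_congr_ae (hf.mono fun ω hω => by simp only [hFTC _ hω])
    _ = ∫⁻ t in Set.Ioi 0, ENNReal.ofReal (p t * g t) := by
        rw [hlc]
        refine setLIntegral_congr_fun measurableSet_Ioi fun t ht => ?_
        simp only [htail t ht, ENNReal.ofReal_mul (hp t ht)]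

lemma IsExpMean.ae_pos {Ω : Type*} [MeasurableSpace Ω] {μ : Measure Ω} [IsProbabilityMeasure μ]
    {X : Ω → ℝ} {γ : ℝ} (hX : IsExpMean μ X γ) (hXm : Measurable X) : ∀ᵐ ω ∂μ, 0 < X ω := by
  have h := hX 0 le_rfl
  simp only [neg_zero, zero_div, Real.exp_zero, ENNReal.ofReal_one] at h
  exact (mem_ae_iff_prob_eq_one (measurableSet_lt measurable_const hXm)).2 h

/-- The Laplace transform of an exponential random variable. -/
lemma IsExpMean.integral_exp_neg_mul {Ω : Type*} [MeasurableSpace Ω] {μ : Measure Ω}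
    [IsProbabilityMeasure μ] {Y : Ω → ℝ} {γ : ℝ} (hγ : 0 < γ) (hY : IsExpMean μ Y γ)
    (hYm : Measurable Y) {s : ℝ} (hs : 0 ≤ s) :
    Integrable (fun ω => Real.exp (-s * Y ω)) μ ∧
      ∫ ω, Real.exp (-s * Y ω) ∂μ = 1 / (1 + s * γ) := by
  have hpos := hY.ae_pos hYm
  have hint : Integrable (fun ω => Real.exp (-s * Y ω)) μ := by
    refine Integrable.of_bound (C := 1) (by fun_prop) (hpos.mono fun ω hω => ?_)
    rw [Real.norm_eq_abs, abs_of_pos (Real.exp_pos _), Real.exp_le_one_iff]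
    nlinarith
  refine ⟨hint, ?_⟩
  have h := integral_comp_eq_integral_tail_mul_deriv (μ := μ) (f := Y)
    (G := fun x => 1 - Real.exp (-s * x)) (g := fun x => s * Real.exp (-s * x))
    (p := fun t => Real.exp (-t / γ)) (hpos.mono fun ω hω => le_of_lt hω) hYm (by fun_prop)
    (fun x _ => by
      have := (((hasDerivAt_id x).const_mul (-s)).exp).const_sub 1
      simp only [id, mul_one] at this
      exact this.congr_deriv (by ring))
    (by simp) (by fun_prop) (fun x _ => by positivity) (by fun_prop)
    (fun t _ => by positivity) (fun t ht => hY t ht.le)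
  have hsg : 0 < s + 1 / γ := by positivity
  have h2 : ∫ t in Set.Ioi (0 : ℝ), Real.exp (-t / γ) * (s * Real.exp (-s * t))
      = s * (1 / (s + 1 / γ)) := by
    have : ∀ t : ℝ, Real.exp (-t / γ) * (s * Real.exp (-s * t))
        = s * Real.exp (-(s + 1 / γ) * t) := fun t => by
      rw [mul_left_comm, ← Real.exp_add]
      congr 2
      ring
    simp only [this]
    rw [integral_const_mul, integral_exp_mul_Ioi (neg_lt_zero.2 hsg)]
    simp only [mul_zero, Real.exp_zero, neg_div_neg_eq]
  rw [h2, integral_sub (integrable_const 1) hint] at h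
  simp only [integral_const, probReal_univ, smul_eq_mul, mul_one] at h
  have h3 : ∫ ω, Real.exp (-s * Y ω) ∂μ = 1 - s * (1 / (s + 1 / γ)) := by linarith
  rw [h3]
  have : (1 + s * γ) ≠ 0 := by positivity
  have : (s * γ + 1) ≠ 0 := by positivity
  field_simp
  ring

/-- The tail of an exponential variable evaluated at an independent nonnegative threshold. -/
lemma IsExpMean.measure_lt_of_indepFun {Ω : Type*} [MeasurableSpace Ω] {μ : Measure Ω}
    [IsProbabilityMeasure μ] {X Y : Ω → ℝ} {γ : ℝ} (hX : IsExpMean μ X γ) (hXm : Measurable X)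
    (hYm : Measurable Y) (hindep : IndepFun X Y μ) {φ : ℝ → ℝ} (hφ : Measurable φ)
    (hφ0 : ∀ᵐ ω ∂μ, 0 ≤ φ (Y ω)) :
    μ {ω | φ (Y ω) < X ω} = ∫⁻ ω, ENNReal.ofReal (Real.exp (-φ (Y ω) / γ)) ∂μ := by
  have hmap := (indepFun_iff_map_prod_eq_prod_map_map hXm.aemeasurable hYm.aemeasurable).1 hindep
  have hS : MeasurableSet {q : ℝ × ℝ | φ q.2 < q.1} :=
    measurableSet_lt (hφ.comp measurable_snd) measurable_fst
  have := Measure.isProbabilityMeasure_map (μ := μ) hXm.aemeasurable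
  have := Measure.isProbabilityMeasure_map (μ := μ) hYm.aemeasurable
  have h1 : μ {ω | φ (Y ω) < X ω} = μ.map (fun ω => (X ω, Y ω)) {q : ℝ × ℝ | φ q.2 < q.1} := by
    rw [Measure.map_apply (hXm.prodMk hYm) hS]
    rfl
  rw [h1, hmap, Measure.prod_apply_symm hS,
    lintegral_map (measurable_measure_prodMk_right hS) hYm]
  refine lintegral_congr_ae (hφ0.mono fun ω hω => ?_)
  simp only
  rw [← hX _ hω, Measure.map_apply hXm (measurable_prodMk_right hS)]
  rfl

lemma integral_Ioi_exp_div_add_eq_expInt {b c : ℝ} (hb : 0 < b) :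
    ∫ t in Set.Ioi (0 : ℝ), Real.exp (-t / b) / (t + c)
      = Real.exp (c / b) * expInt (c / b) := by
  have h1 := (measurePreserving_add_right volume c).setIntegral_preimage_emb
    (measurableEmbedding_addRight c) (fun u => Real.exp (-u / b) / u) (Set.Ioi c)
  have h2 := integral_comp_mul_left_Ioi (fun u => Real.exp (-u) / u) c (inv_pos.2 hb)
  rw [inv_inv, smul_eq_mul, inv_mul_eq_div] at h2
  have hpre : (fun x : ℝ => x + c) ⁻¹' Set.Ioi c = Set.Ioi 0 := by
    ext x
    simp
  rw [hpre] at h1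
  have h3 : ∀ t : ℝ, Real.exp (-t / b) / (t + c)
      = Real.exp (c / b) * (Real.exp (-(t + c) / b) / (t + c)) := fun t => by
    rw [← mul_div_assoc, ← Real.exp_add]
    congr 2
    ring
  have h4 : ∀ t : ℝ, Real.exp (-t / b) / t
      = b⁻¹ * (Real.exp (-(b⁻¹ * t)) / (b⁻¹ * t)) := fun t => by
    rw [show -(b⁻¹ * t) = -t / b by ring]
    rcases eq_or_ne t 0 with rfl | ht
    · simp
    · field_simp
  simp only [h3]
  rw [integral_const_mul, h1]
  simp only [h4]
  rw [integral_const_mul, h2, inv_mul_cancel_left₀ hb.ne', expInt]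

lemma integrableOn_Ioi_exp_div_add {b c : ℝ} (hb : 0 < b) (hc : 0 < c) :
    IntegrableOn (fun t => Real.exp (-t / b) / (t + c)) (Set.Ioi 0) := by
  have h := integrableOn_exp_mul_Ioi (neg_lt_zero.2 (inv_pos.2 hb)) 0
  have h2 := Integrable.bdd_mul (f := fun t : ℝ => (t + c)⁻¹) (c := c⁻¹) h
    (Measurable.aestronglyMeasurable (by fun_prop))
    ((ae_restrict_mem measurableSet_Ioi).mono fun t ht => by
      have ht : 0 < t := ht
      rw [Real.norm_eq_abs, abs_of_pos (by positivity)]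
      gcongr
      linarith)
  refine h2.congr (.of_forall fun t => ?_)
  simp only
  rw [show -b⁻¹ * t = -t / b by ring]
  ring

theorem stmt_13 {Ω : Type*} [MeasurableSpace Ω] (μ : Measure Ω) [IsProbabilityMeasure μ]
    (γS γR a₁ : ℝ) (hγS : 0 < γS) (hγR : 0 < γR) (ha₁ : 0 < a₁) (hne : γR ≠ a₁ * γS)
    (X Y : Ω → ℝ) (hXm : Measurable X) (hYm : Measurable Y)
    (hX : IsExpMean μ X γS) (hY : IsExpMean μ Y γR)
    (hindep : IndepFun X Y μ) :
    ∫ ω, Real.logb 2 (1 + a₁ * X ω / (Y ω + 1)) ∂μ =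
      (1 / Real.log 2) * (a₁ * γS / (γR - a₁ * γS)) *
        (Real.exp (1 / γR) * expInt (1 / γR) -
          Real.exp (1 / (a₁ * γS)) * expInt (1 / (a₁ * γS))) := by
  set b := a₁ * γS with hb_def
  have hb : 0 < b := mul_pos ha₁ hγS
  have hX0 := hX.ae_pos hXm
  have hY0 := hY.ae_pos hYm
  have htail : ∀ t, 0 < t → μ {ω | t < a₁ * X ω / (Y ω + 1)}
      = ENNReal.ofReal (Real.exp (-t / b) * (1 / (1 + t / b * γR))) := fun t ht => by
    have hset : μ {ω | t < a₁ * X ω / (Y ω + 1)}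
        = μ {ω | (fun y => t * (y + 1) / a₁) (Y ω) < X ω} := by
      refine measure_congr (hY0.mono fun ω hω => ?_)
      refine propext ?_
      change t < a₁ * X ω / (Y ω + 1) ↔ t * (Y ω + 1) / a₁ < X ω
      rw [lt_div_iff₀ (by linarith), div_lt_iff₀ ha₁, mul_comm a₁]
    obtain ⟨hint, hval⟩ := hY.integral_exp_neg_mul hγR hYm (s := t / b) (by positivity)
    rw [hset, hX.measure_lt_of_indepFun hXm hYm hindep (φ := fun y => t * (y + 1) / a₁) (by fun_prop)
      (hY0.mono fun ω hω => by positivity), ← hval, ← integral_const_mul,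
      ofReal_integral_eq_lintegral_ofReal (hint.const_mul _)
        (.of_forall fun ω => by positivity)]
    refine lintegral_congr fun ω => ?_
    rw [← Real.exp_add]
    congr 2
    rw [hb_def]
    field_simp
    ring
  have hmain := integral_comp_eq_integral_tail_mul_deriv (μ := μ)
    (f := fun ω => a₁ * X ω / (Y ω + 1)) (G := fun x => Real.log (1 + x))
    (g := fun x => (1 + x)⁻¹)
    (p := fun t => Real.exp (-t / b) * (1 / (1 + t / b * γR)))
    (by
      filter_upwards [hX0, hY0] with ω h1 h2
      simp only [Pi.zero_apply]
      positivity)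
    (by fun_prop) (by fun_prop)
    (fun x hx => by
      have := ((hasDerivAt_id x).const_add 1).log (by simp only [id]; positivity)
      simpa using this)
    (by simp)
    (ContinuousOn.inv₀ (by fun_prop) fun x hx => by
      have : (0 : ℝ) ≤ x := hx
      positivity)
    (fun x hx => by positivity) (by fun_prop) (fun t ht => by positivity) htail
  have hsub : γR - b ≠ 0 := sub_ne_zero.2 hne
  have hpf : ∀ t ∈ Set.Ioi (0 : ℝ),
      Real.exp (-t / b) * (1 / (1 + t / b * γR)) * (1 + t)⁻¹
        = b / (γR - b) * (Real.exp (-t / b) / (t + b / γR) - Real.exp (-t / b) / (t + 1)) := by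
    intro t ht
    have ht : 0 < t := ht
    have h1 : b + t * γR ≠ 0 := by positivity
    have h2 : t * γR + b ≠ 0 := by positivity
    have h3 : 1 + t ≠ 0 := by positivity
    have h4 : t + 1 ≠ 0 := by positivity
    field_simp
    ring
  rw [setIntegral_congr_fun measurableSet_Ioi hpf, integral_const_mul,
    integral_sub (integrableOn_Ioi_exp_div_add hb (by positivity))
      (integrableOn_Ioi_exp_div_add hb one_pos),
    integral_Ioi_exp_div_add_eq_expInt hb, integral_Ioi_exp_div_add_eq_expInt hb,
    show b / γR / b = 1 / γR by field_simp] at hmain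
  simp only [Real.logb, div_eq_mul_inv (Real.log (1 + _))]
  rw [integral_mul_const, hmain]
  ring
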